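/- arXiv:1301.5701 — 3 statements merged into one kernel-verified Lean document; each statement's English description precedes it below -/
import Mathlib

section
/- Let t, n be positive integers, H a real t×n matrix with HᵀH invertible, and A a real n×t matrix satisfying AH = I_n (the unbiasedness condition for the linear estimator AY). Then the matrix AAᵀ − (HᵀH)⁻¹ is positive semidefinite. Consequently, for noise with covariance σ²I_t, the covariance σ²AAᵀ of any linear unbiased estimator dominates the LS covariance σ²(HᵀH)⁻¹ in the positive semidefinite (Loewner) order, i.e., the LS estimator is the best linear unbiased estimator (BLUE). -/
open Matrix

/-- For `A` a left inverse of `H`, the excess of `A * Aᵀ` over `(Hᵀ * H)⁻¹` is the Gram matrix of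
the deviation of `A` from the least squares estimator `(Hᵀ * H)⁻¹ * Hᵀ`. -/
theorem mul_transpose_sub_inv_gram_eq {R m k : Type*} [CommRing R] [Fintype m] [Fintype k]
    [DecidableEq k] {H : Matrix m k R} (hU : IsUnit (Hᵀ * H)) {A : Matrix k m R}
    (hA : A * H = 1) :
    A * Aᵀ - (Hᵀ * H)⁻¹ = (A - (Hᵀ * H)⁻¹ * Hᵀ) * (A - (Hᵀ * H)⁻¹ * Hᵀ)ᵀ := by
  have hdet : IsUnit (Hᵀ * H).det := (isUnit_iff_isUnit_det _).mp hU
  have hsymm : ((Hᵀ * H)⁻¹)ᵀ = (Hᵀ * H)⁻¹ := by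
    rw [transpose_nonsing_inv, transpose_mul, transpose_transpose]
  have hAt : Hᵀ * Aᵀ = 1 := by rw [← transpose_mul, hA, transpose_one]
  have hcross : A * (H * (Hᵀ * H)⁻¹) = (Hᵀ * H)⁻¹ := by
    rw [← Matrix.mul_assoc, hA, Matrix.one_mul]
  have hgram : Hᵀ * (H * (Hᵀ * H)⁻¹) = 1 := by
    rw [← Matrix.mul_assoc, mul_nonsing_inv _ hdet]
  rw [transpose_sub, transpose_mul, transpose_transpose, hsymm, Matrix.sub_mul, Matrix.mul_sub,
    Matrix.mul_sub, hcross, Matrix.mul_assoc, Matrix.mul_assoc, hAt, hgram, Matrix.mul_one]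
  abel

/-- The least squares estimator is the best linear unbiased estimator (BLUE):
for any `A` with `AH = I` (unbiasedness), `AAᵀ − (HᵀH)⁻¹` is positive semidefinite,
and hence `σ²AAᵀ − σ²(HᵀH)⁻¹` is positive semidefinite. -/
theorem ls_is_blue (t n : ℕ) (ht : 0 < t) (hn : 0 < n)
    (H : Matrix (Fin t) (Fin n) ℝ) (hU : IsUnit (Hᵀ * H))
    (A : Matrix (Fin n) (Fin t) ℝ) (hA : A * H = 1) :
    (A * Aᵀ - (Hᵀ * H)⁻¹).PosSemidef ∧
    ∀ σ : ℝ, 0 < σ → (σ ^ 2 • (A * Aᵀ) - σ ^ 2 • (Hᵀ * H)⁻¹).PosSemidef := by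
  have hpsd : (A * Aᵀ - (Hᵀ * H)⁻¹).PosSemidef := by
    rw [mul_transpose_sub_inv_gram_eq hU hA, ← conjTranspose_eq_transpose_of_trivial (A - _)]
    exact posSemidef_self_mul_conjTranspose _
  refine ⟨hpsd, fun σ _ => ?_⟩
  rw [← smul_sub]
  exact hpsd.smul (sq_nonneg σ)
end

section
/- Fix a real constant a > 0 and a Borel probability measure μ on ℝ. Define the Bellman iterates V₀, V₁, V₂, … : [0, ∞) → ℝ by V₀(z) = 0 and V_m(z) = min{a z, 1 + ∫_ℝ V_{m−1}(z/(1 + z s²)) dμ(s)} for m ≥ 1. Then every iterate V_m is non-decreasing and concave on [0, ∞). -/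
open Set MeasureTheory

/-- The Bellman iterates `V₀(z) = 0`,
`V_m(z) = min{az, 1 + ∫ V_{m−1}(z/(1 + zs²)) dμ(s)}`. -/
noncomputable def bellmanIter (a : ℝ) (μ : Measure ℝ) : ℕ → ℝ → ℝ
  | 0 => fun _ => 0
  | m + 1 => fun z =>
      min (a * z) (1 + ∫ s, bellmanIter a μ m (z / (1 + z * s ^ 2)) ∂μ)

theorem monotoneOn_div_one_add_mul {c : ℝ} (hc : 0 ≤ c) :
    MonotoneOn (fun z : ℝ => z / (1 + z * c)) (Ici 0) := by
  intro x hx y hy hxy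
  rw [mem_Ici] at hx hy
  change x / (1 + x * c) ≤ y / (1 + y * c)
  rw [div_le_div_iff₀ (by positivity) (by positivity)]
  linarith

theorem concaveOn_div_one_add_mul {c : ℝ} (hc : 0 ≤ c) :
    ConcaveOn ℝ (Ici 0) (fun z : ℝ => z / (1 + z * c)) := by
  have tangent : ∀ x m : ℝ, 0 ≤ x → 0 ≤ m →
      x / (1 + x * c) ≤ m / (1 + m * c) + (x - m) / (1 + m * c) ^ 2 := by
    intro x m hx hm
    have hx' : 0 < 1 + x * c := by positivity
    have hm' : 0 < 1 + m * c := by positivity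
    have key : m / (1 + m * c) + (x - m) / (1 + m * c) ^ 2 - x / (1 + x * c) =
        c * (x - m) ^ 2 / ((1 + m * c) ^ 2 * (1 + x * c)) := by
      field_simp
      ring
    have : 0 ≤ c * (x - m) ^ 2 / ((1 + m * c) ^ 2 * (1 + x * c)) := by positivity
    linarith
  refine ⟨convex_Ici 0, fun x hx y hy p q hp hq hpq => ?_⟩
  have hm : p * x + q * y ∈ Ici (0 : ℝ) := convex_Ici (0 : ℝ) hx hy hp hq hpq
  simp only [smul_eq_mul]
  set m := p * x + q * y with hmdef
  calc p * (x / (1 + x * c)) + q * (y / (1 + y * c))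
      ≤ p * (m / (1 + m * c) + (x - m) / (1 + m * c) ^ 2)
        + q * (m / (1 + m * c) + (y - m) / (1 + m * c) ^ 2) :=
        add_le_add (mul_le_mul_of_nonneg_left (tangent x m hx hm) hp)
          (mul_le_mul_of_nonneg_left (tangent y m hy hm) hq)
    _ = (p + q) * (m / (1 + m * c)) + (m - (p + q) * m) / (1 + m * c) ^ 2 := by
        rw [hmdef]; ring
    _ = m / (1 + m * c) := by rw [hpq]; simp

/-- A function that is monotone on `[0, ∞)` is bounded along `s ↦ z / (1 + z * s ^ 2)`. -/
theorem MonotoneOn.integrable_comp_div_one_add_mul_sq {V : ℝ → ℝ} (hV : MonotoneOn V (Ici 0))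
    (μ : Measure ℝ) [IsFiniteMeasure μ] {z : ℝ} (hz : 0 ≤ z) :
    Integrable (fun s => V (z / (1 + z * s ^ 2))) μ := by
  have hnonneg : ∀ s : ℝ, 0 ≤ z / (1 + z * s ^ 2) := fun s => by positivity
  have hle : ∀ s : ℝ, z / (1 + z * s ^ 2) ≤ z := fun s =>
    div_le_self hz (le_add_of_nonneg_right (by positivity))
  have hmono : Monotone (fun x => V (max 0 x)) := fun x y hxy =>
    hV (le_max_left 0 x) (le_max_left 0 y) (max_le_max le_rfl hxy)
  have hmeas : Measurable (fun s => V (z / (1 + z * s ^ 2))) := by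
    have : Measurable (fun s : ℝ => z / (1 + z * s ^ 2)) := by fun_prop
    simpa only [Function.comp_def, max_eq_right (hnonneg _)] using hmono.measurable.comp this
  exact Integrable.of_mem_Icc (V 0) (V z) hmeas.aemeasurable (Filter.Eventually.of_forall fun s =>
    ⟨hV self_mem_Ici (hnonneg s) (hnonneg s), hV (hnonneg s) hz (hle s)⟩)

theorem MonotoneOn.integral_comp_div_one_add_mul_sq {V : ℝ → ℝ} (hV : MonotoneOn V (Ici 0))
    (μ : Measure ℝ) [IsFiniteMeasure μ] :
    MonotoneOn (fun z => ∫ s, V (z / (1 + z * s ^ 2)) ∂μ) (Ici 0) := by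
  intro x hx y hy hxy
  rw [mem_Ici] at hx hy
  refine integral_mono (hV.integrable_comp_div_one_add_mul_sq μ hx)
    (hV.integrable_comp_div_one_add_mul_sq μ hy) fun s => ?_
  exact hV (mem_Ici.2 (by positivity)) (mem_Ici.2 (by positivity))
    (monotoneOn_div_one_add_mul (sq_nonneg s) hx hy hxy)

theorem ConcaveOn.integral_comp_div_one_add_mul_sq {V : ℝ → ℝ} (hc : ConcaveOn ℝ (Ici 0) V)
    (hV : MonotoneOn V (Ici 0)) (μ : Measure ℝ) [IsFiniteMeasure μ] :
    ConcaveOn ℝ (Ici 0) (fun z => ∫ s, V (z / (1 + z * s ^ 2)) ∂μ) := by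
  refine ⟨convex_Ici 0, fun x hx y hy p q hp hq hpq => ?_⟩
  have hm : p • x + q • y ∈ Ici (0 : ℝ) := convex_Ici (0 : ℝ) hx hy hp hq hpq
  have hix := (hV.integrable_comp_div_one_add_mul_sq μ hx).smul p
  have hiy := (hV.integrable_comp_div_one_add_mul_sq μ hy).smul q
  simp only [← integral_smul]
  refine (integral_add hix hiy).symm.trans_le ?_
  refine integral_mono (hix.add hiy) (hV.integrable_comp_div_one_add_mul_sq μ hm) fun s => ?_
  have hnonneg : ∀ z ∈ Ici (0 : ℝ), z / (1 + z * s ^ 2) ∈ Ici (0 : ℝ) := fun z hz => by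
    rw [mem_Ici] at hz ⊢
    positivity
  exact (hc.2 (hnonneg x hx) (hnonneg y hy) hp hq hpq).trans
    (hV (convex_Ici (0 : ℝ) (hnonneg x hx) (hnonneg y hy) hp hq hpq) (hnonneg _ hm)
      ((concaveOn_div_one_add_mul (sq_nonneg s)).2 hx hy hp hq hpq))

/-- Every Bellman iterate is non-decreasing and concave on `[0, ∞)`. -/
theorem bellmanIter_monotone_concave (a : ℝ) (ha : 0 < a)
    (μ : Measure ℝ) [IsProbabilityMeasure μ] :
    ∀ m : ℕ,
      MonotoneOn (bellmanIter a μ m) (Ici (0 : ℝ)) ∧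
      ConcaveOn ℝ (Ici (0 : ℝ)) (bellmanIter a μ m) := by
  intro m
  induction m with
  | zero => exact ⟨monotoneOn_const, concaveOn_const 0 (convex_Ici 0)⟩
  | succ m ih =>
    obtain ⟨hmono, hconc⟩ := ih
    have hlin : ConcaveOn ℝ (Ici (0 : ℝ)) (fun z => a * z) :=
      (concaveOn_id (convex_Ici 0)).smul ha.le
    constructor
    · intro x hx y hy hxy
      exact min_le_min (mul_le_mul_of_nonneg_left hxy ha.le)
        (add_le_add le_rfl (hmono.integral_comp_div_one_add_mul_sq μ hx hy hxy))
    · exact hlin.inf ((concaveOn_const 1 (convex_Ici 0)).add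
        (hconc.integral_comp_div_one_add_mul_sq hmono μ))
end

section
/- Fix a real constant a > 0 and a Borel probability measure μ on ℝ, and define the Bellman iterates V₀, V₁, V₂, … : [0, ∞) → ℝ by V₀(z) = 0 and V_m(z) = min{a z, 1 + ∫_ℝ V_{m−1}(z/(1 + z s²)) dμ(s)} for m ≥ 1. Suppose c > 1 satisfies ∫_ℝ (c − a/s²)⁺ dμ(s) > 1 (integrand 0 at s = 0). Then V_m(z) ≤ min{a z, c} for every m ≥ 0 and every z ≥ 0; i.e., the iterates are uniformly bounded. -/
open Set MeasureTheory

theorem min_mul_div_le_sub_posPart {a c z : ℝ} (ha : 0 < a) (hz : 0 ≤ z) (s : ℝ) :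
    min (a * (z / (1 + z * s ^ 2))) c ≤
      c - (if s = 0 then 0 else max (c - a / s ^ 2) 0) := by
  split_ifs with hs
  · simp
  have hs2 : 0 < s ^ 2 := by positivity
  have hdiv : z / (1 + z * s ^ 2) ≤ 1 / s ^ 2 := by
    rw [div_le_div_iff₀ (by positivity) hs2]
    linarith
  have hle : a * (z / (1 + z * s ^ 2)) ≤ a / s ^ 2 := by
    simpa [div_eq_mul_inv] using mul_le_mul_of_nonneg_left hdiv ha.le
  rcases le_total (c - a / s ^ 2) 0 with h | h
  · rw [max_eq_right h, sub_zero]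
    exact min_le_right _ _
  · rw [max_eq_left h, sub_sub_cancel]
    exact (min_le_left _ _).trans hle

/-- Uniform boundedness of the Bellman iterates: if `c > 1` satisfies
`∫ (c − a/s²)⁺ dμ > 1` (integrand `0` at `s = 0`), then `V_m(z) ≤ min{az, c}`
for all `m` and all `z ≥ 0`. -/
theorem bellmanIter_uniform_bound (a : ℝ) (ha : 0 < a)
    (μ : Measure ℝ) [IsProbabilityMeasure μ]
    (c : ℝ) (hc : 1 < c)
    (hint : (∫ s, (if s = 0 then 0 else max (c - a / s ^ 2) 0) ∂μ) > 1) :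
    ∀ (m : ℕ) (z : ℝ), 0 ≤ z → bellmanIter a μ m z ≤ min (a * z) c := by
  intro m
  induction m with
  | zero =>
    intro z hz
    exact le_min (mul_nonneg ha.le hz) (by linarith : (0 : ℝ) ≤ c)
  | succ m ih =>
    intro z hz
    rw [bellmanIter]
    refine le_min (min_le_left _ _) ((min_le_right _ _).trans ?_)
    by_cases hV : Integrable (fun s => bellmanIter a μ m (z / (1 + z * s ^ 2))) μ
    · have hg : Integrable (fun s => if s = 0 then 0 else max (c - a / s ^ 2) 0) μ :=
        Integrable.of_integral_ne_zero (by linarith)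
      have hle := integral_mono hV ((integrable_const c).sub hg) fun s =>
        (ih _ (by positivity)).trans (min_mul_div_le_sub_posPart ha hz s)
      simp only [Pi.sub_apply] at hle
      rw [integral_sub (integrable_const c) hg, integral_const, probReal_univ, one_smul] at hle
      linarith
    · rw [integral_undef hV]
      linarith
end
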